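/- arXiv:2202.07090 — 4 statements merged into one kernel-verified Lean document; each statement's English description precedes it below -/
import Mathlib

section
/- For every integer n ≥ 1, the group presented by generators x_1, y_1, …, x_n, y_n subject to the relations y_k x_k = x_{k+1} y_k and x_{k+1} y_k = y_{k+1} x_{k+1} for k = 1, …, n (with the cyclic conventions x_{n+1} = x_1 and y_{n+1} = y_1) is isomorphic to the group Γ_n = ⟨a, b | a^n b a^{-n} b^{-1}⟩. -/
/-- The single relator `a^n b a^{-n} b^{-1}` of the group `Γ_n`, inside the free
group on two generators (`0 ↦ a`, `1 ↦ b`). -/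
def hopfRels (n : ℕ) : Set (FreeGroup (Fin 2)) :=
  {(FreeGroup.of 0) ^ n * FreeGroup.of 1 * ((FreeGroup.of 0) ^ n)⁻¹ * (FreeGroup.of 1)⁻¹}

/-- The relators of the Wirtinger presentation of the twisted Hopf link with `n` twists:
generators `x_k = Sum.inl k`, `y_k = Sum.inr k` for `k : Fin n`, relations
`y_k x_k = x_{k+1} y_k` and `x_{k+1} y_k = y_{k+1} x_{k+1}` with the cyclic convention
`k + 1` computed via `finRotate`. -/
def wirtingerRels (n : ℕ) : Set (FreeGroup (Fin n ⊕ Fin n)) :=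
  {r | (∃ k : Fin n,
          r = FreeGroup.of (Sum.inr k) * FreeGroup.of (Sum.inl k) *
              (FreeGroup.of (Sum.inl (finRotate n k)) * FreeGroup.of (Sum.inr k))⁻¹) ∨
       (∃ k : Fin n,
          r = FreeGroup.of (Sum.inl (finRotate n k)) * FreeGroup.of (Sum.inr k) *
              (FreeGroup.of (Sum.inr (finRotate n k)) *
                FreeGroup.of (Sum.inl (finRotate n k)))⁻¹)}

theorem conj_pow_step {G : Type*} [Group G] (a b : G) (i : ℕ) :
    a * (a ^ i * b * (a ^ i)⁻¹) * a⁻¹ = a ^ (i + 1) * b * (a ^ (i + 1))⁻¹ := by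
  rw [pow_succ' a i, mul_inv_rev]
  simp only [mul_assoc]

theorem hopf_rel (n : ℕ) :
    (PresentedGroup.of 0 : PresentedGroup (hopfRels n)) ^ n * PresentedGroup.of 1 *
      ((PresentedGroup.of 0) ^ n)⁻¹ = PresentedGroup.of 1 := by
  have h : PresentedGroup.mk (hopfRels n) _ = 1 :=
    PresentedGroup.one_of_mem (rels := hopfRels n) (Set.mem_singleton _)
  simp only [map_mul, map_inv, map_pow] at h
  exact mul_inv_eq_one.mp h

theorem wirt_rel1 (n : ℕ) (k : Fin n) :
    (PresentedGroup.of (Sum.inr k) : PresentedGroup (wirtingerRels n)) *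
      PresentedGroup.of (Sum.inl k) =
    PresentedGroup.of (Sum.inl (finRotate n k)) * PresentedGroup.of (Sum.inr k) := by
  have h : PresentedGroup.mk (wirtingerRels n) _ = 1 :=
    PresentedGroup.one_of_mem (rels := wirtingerRels n) (Or.inl ⟨k, rfl⟩)
  rw [map_mul, map_inv, map_mul, map_mul] at h
  exact mul_inv_eq_one.mp h

theorem wirt_rel2 (n : ℕ) (k : Fin n) :
    (PresentedGroup.of (Sum.inl (finRotate n k)) : PresentedGroup (wirtingerRels n)) *
      PresentedGroup.of (Sum.inr k) =
    PresentedGroup.of (Sum.inr (finRotate n k)) *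
      PresentedGroup.of (Sum.inl (finRotate n k)) := by
  have h : PresentedGroup.mk (wirtingerRels n) _ = 1 :=
    PresentedGroup.one_of_mem (rels := wirtingerRels n) (Or.inr ⟨k, rfl⟩)
  rw [map_mul, map_inv, map_mul, map_mul] at h
  exact mul_inv_eq_one.mp h

/-- Conjugates of `b` by powers of `a` behave cyclically once `a ^ (m + 1)` commutes with `b`. -/
theorem conj_rotate {G : Type*} [Group G] (m : ℕ) (a b : G)
    (h : a ^ (m + 1) * b * (a ^ (m + 1))⁻¹ = b) (k : Fin (m + 1)) :
    a ^ (finRotate (m + 1) k : ℕ) * b * (a ^ (finRotate (m + 1) k : ℕ))⁻¹ =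
      a * (a ^ (k : ℕ) * b * (a ^ (k : ℕ))⁻¹) * a⁻¹ := by
  by_cases hk : k = Fin.last m
  · subst hk
    rw [finRotate_last]
    simp only [Fin.val_last, Fin.val_zero, pow_zero]
    rw [pow_succ'] at h
    rw [one_mul, inv_one, mul_one]
    conv_lhs => rw [← h]
    group
  · rw [coe_finRotate_of_ne_last hk, pow_succ']
    group

/-- In the Wirtinger group the products `y_k x_k` are constant and the `x_k` are conjugates. -/
theorem wirt_gen (m : ℕ) (k : Fin (m + 1)) :
    let x : Fin (m + 1) → PresentedGroup (wirtingerRels (m + 1)) :=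
      fun k => PresentedGroup.of (Sum.inl k)
    let y : Fin (m + 1) → PresentedGroup (wirtingerRels (m + 1)) :=
      fun k => PresentedGroup.of (Sum.inr k)
    y k * x k = y 0 * x 0 ∧ x k = (y 0 * x 0) ^ (k : ℕ) * x 0 * ((y 0 * x 0) ^ (k : ℕ))⁻¹ := by
  intro x y
  have r1 : ∀ k, y k * x k = x (finRotate _ k) * y k := wirt_rel1 (m + 1)
  have r2 : ∀ k, x (finRotate _ k) * y k = y (finRotate _ k) * x (finRotate _ k) :=
    wirt_rel2 (m + 1)
  induction k using Fin.induction with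
  | zero => simp
  | succ i ih =>
    have hrot : finRotate (m + 1) i.castSucc = i.succ := by
      rw [finRotate_apply]; simp
    have h1 := r1 i.castSucc
    have h2 := r2 i.castSucc
    rw [hrot] at h1 h2
    obtain ⟨e1, e2⟩ := ih
    refine ⟨by rw [← h2, ← h1, e1], ?_⟩
    have h3 : x i.succ = (y 0 * x 0) * x i.castSucc * (y 0 * x 0)⁻¹ := by
      rw [← e1]
      rw [eq_mul_inv_of_mul_eq h1.symm]
      group
    rw [h3, e2]
    simp only [Fin.val_castSucc, Fin.val_succ]
    exact conj_pow_step _ _ _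

theorem wirt_close (m : ℕ) :
    let x : PresentedGroup (wirtingerRels (m + 1)) := PresentedGroup.of (Sum.inl 0)
    let y : PresentedGroup (wirtingerRels (m + 1)) := PresentedGroup.of (Sum.inr 0)
    (y * x) ^ (m + 1) * x * ((y * x) ^ (m + 1))⁻¹ = x := by
  intro x y
  obtain ⟨e1, e2⟩ := wirt_gen m (Fin.last m)
  have h1 := wirt_rel1 (m + 1) (Fin.last m)
  rw [finRotate_last] at h1
  have h3 : x = (y * x) * PresentedGroup.of (Sum.inl (Fin.last m)) * (y * x)⁻¹ := by
    rw [← e1]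
    change PresentedGroup.of (Sum.inl 0) = _
    rw [eq_mul_inv_of_mul_eq h1.symm]
    group
  have h4 := h3.trans (congrArg (fun t => (y * x) * t * (y * x)⁻¹) e2)
  exact (h4.trans (conj_pow_step _ _ _)).symm

/-- The images of the Wirtinger generators. -/
def wirtFun (m : ℕ) : Fin (m + 1) ⊕ Fin (m + 1) → PresentedGroup (hopfRels (m + 1)) :=
  Sum.elim
    (fun k => PresentedGroup.of 0 ^ (k : ℕ) * PresentedGroup.of 1 *
      (PresentedGroup.of 0 ^ (k : ℕ))⁻¹)
    (fun k => PresentedGroup.of 0 * (PresentedGroup.of 0 ^ (k : ℕ) * PresentedGroup.of 1 *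
      (PresentedGroup.of 0 ^ (k : ℕ))⁻¹)⁻¹)

/-- The images of the generators `a`, `b`. -/
def hopfFun (m : ℕ) : Fin 2 → PresentedGroup (wirtingerRels (m + 1)) :=
  ![PresentedGroup.of (Sum.inr 0) * PresentedGroup.of (Sum.inl 0), PresentedGroup.of (Sum.inl 0)]

theorem wirtFun_rels (m : ℕ) :
    ∀ r ∈ wirtingerRels (m + 1), FreeGroup.lift (wirtFun m) r = 1 := by
  have key := conj_rotate m _ _ (hopf_rel (m + 1))
  rintro r (⟨k, rfl⟩ | ⟨k, rfl⟩)
  · simp only [map_mul, map_inv, FreeGroup.lift_apply_of, wirtFun, Sum.elim_inl, Sum.elim_inr,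
      key k]
    group
  · simp only [map_mul, map_inv, FreeGroup.lift_apply_of, wirtFun, Sum.elim_inl, Sum.elim_inr,
      key k]
    group

theorem hopfFun_rels (m : ℕ) :
    ∀ r ∈ hopfRels (m + 1), FreeGroup.lift (hopfFun m) r = 1 := by
  rintro r rfl
  simp only [map_mul, map_inv, map_pow, FreeGroup.lift_apply_of]
  exact mul_inv_eq_one.mpr (wirt_close m)

/-- The Wirtinger presentation of the fundamental group of the complement of the twisted
Hopf link with `n ≥ 1` twists is isomorphic to `Γ_n = ⟨a, b | a^n b a^{-n} b^{-1}⟩`. -/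
theorem wirtinger_iso_gamma (n : ℕ) (hn : 1 ≤ n) :
    Nonempty (PresentedGroup (wirtingerRels n) ≃* PresentedGroup (hopfRels n)) := by
  obtain ⟨m, rfl⟩ : ∃ m, n = m + 1 := ⟨n - 1, by omega⟩
  refine ⟨MonoidHom.toMulEquiv (PresentedGroup.toGroup (wirtFun_rels m))
    (PresentedGroup.toGroup (hopfFun_rels m)) ?_ ?_⟩
  · apply PresentedGroup.ext
    rintro (k | k)
    · have e2 := (wirt_gen m k).2
      simp only [MonoidHom.comp_apply, PresentedGroup.toGroup.of, wirtFun, Sum.elim_inl, map_mul,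
        map_inv, map_pow, MonoidHom.id_apply]
      exact e2.symm
    · obtain ⟨e1, e2⟩ := wirt_gen m k
      simp only [MonoidHom.comp_apply, PresentedGroup.toGroup.of, wirtFun, Sum.elim_inr, map_mul,
        map_inv, map_pow, MonoidHom.id_apply]
      refine Eq.trans (congrArg₂ (fun u v => u * v⁻¹) e1.symm e2.symm) ?_
      simp
  · apply PresentedGroup.ext
    intro i
    fin_cases i
    · simp [hopfFun, wirtFun]
    · simp [hopfFun, wirtFun]
end

section
/- Let r ≥ 2 and n ≥ 1 be integers, and let A, B be r×r complex matrices with A invertible. If A is not diagonalizable and A^n B = B A^n, then the pair (A, B) is reducible, i.e. there exists a linear subspace W of ℂ^r with W ≠ 0 and W ≠ ℂ^r such that A(W) ⊆ W and B(W) ⊆ W. -/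
theorem reducible_aux_diag (r : ℕ) (A : Matrix (Fin r) (Fin r) ℂ)
    (h : ⨆ μ, Module.End.eigenspace (Matrix.toLin' A) μ = ⊤) :
    ∃ (P : Matrix (Fin r) (Fin r) ℂ) (d : Fin r → ℂ),
        IsUnit P ∧ A = P * Matrix.diagonal d * P⁻¹ := by
  let S : Set (Fin r → ℂ) := {v | ∃ μ : ℂ, A.mulVec v = μ • v}
  have hS : ⊤ ≤ Submodule.span ℂ S := by
    rw [← h]
    refine iSup_le fun μ v hv => Submodule.subset_span ⟨μ, ?_⟩
    simpa [Module.End.mem_eigenspace_iff] using hv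
  let b0 := Module.Basis.ofSpan hS
  have hb0 : ∀ i, b0 i ∈ S := fun i => Module.Basis.ofSpan_subset hS ⟨i, rfl⟩
  haveI := Module.Finite.finite_basis b0
  haveI := Fintype.ofFinite (↑((linearIndepOn_empty ℂ id).extend (Set.empty_subset S)) : Type)
  have hcard : Fintype.card (↑((linearIndepOn_empty ℂ id).extend (Set.empty_subset S)) : Type) = r := by
    rw [← Module.finrank_eq_card_basis b0]; simp
  let b := b0.reindex (Fintype.equivFinOfCardEq hcard)
  have hb : ∀ i, b i ∈ S := fun i => by simpa [b] using hb0 _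
  choose d hd using hb
  let P : Matrix (Fin r) (Fin r) ℂ := (Pi.basisFun ℂ (Fin r)).toMatrix b
  have hP : IsUnit P := by
    have := (Pi.basisFun ℂ (Fin r)).invertibleToMatrix b
    exact isUnit_of_invertible P
  refine ⟨P, d, hP, ?_⟩
  have hAP : A * P = P * Matrix.diagonal d := by
    ext i j
    have := congrFun (hd j) i
    rw [Matrix.mul_diagonal, Matrix.mul_apply]
    simpa [P, Module.Basis.toMatrix_apply, Matrix.mulVec, dotProduct, mul_comm] using this
  rw [← hAP, Matrix.mul_nonsing_inv_cancel_right]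
  exact (Matrix.isUnit_iff_isUnit_det P).1 hP

/-- Let `r ≥ 2`, `n ≥ 1`, and let `A, B` be `r×r` complex matrices with `A` invertible.
If `A` is not diagonalizable (not conjugate to a diagonal matrix) and `A^n B = B A^n`,
then the pair `(A, B)` is reducible: there is a linear subspace `W` of `ℂ^r` with
`W ≠ 0`, `W ≠ ℂ^r`, invariant under both `A` and `B`. -/
theorem reducible_of_not_diagonalizable (r n : ℕ) (hr : 2 ≤ r) (hn : 1 ≤ n)
    (A B : Matrix (Fin r) (Fin r) ℂ) (hA : IsUnit A)
    (hdiag : ¬ ∃ (P : Matrix (Fin r) (Fin r) ℂ) (d : Fin r → ℂ),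
        IsUnit P ∧ A = P * Matrix.diagonal d * P⁻¹)
    (hcomm : A ^ n * B = B * A ^ n) :
    ∃ W : Submodule ℂ (Fin r → ℂ), W ≠ ⊥ ∧ W ≠ ⊤ ∧
      (∀ v ∈ W, A.mulVec v ∈ W) ∧ (∀ v ∈ W, B.mulVec v ∈ W) := by
  haveI : Nonempty (Fin r) := ⟨⟨0, by omega⟩⟩
  obtain ⟨μ, hμ⟩ := Module.End.exists_eigenvalue (Matrix.toLin' (A ^ n))
  have key : ∀ C : Matrix (Fin r) (Fin r) ℂ, A ^ n * C = C * A ^ n →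
      ∀ v ∈ Module.End.eigenspace (Matrix.toLin' (A ^ n)) μ,
        C.mulVec v ∈ Module.End.eigenspace (Matrix.toLin' (A ^ n)) μ := by
    intro C hC v hv
    rw [Module.End.mem_eigenspace_iff, Matrix.toLin'_apply] at hv ⊢
    rw [Matrix.mulVec_mulVec, hC, ← Matrix.mulVec_mulVec, hv, Matrix.mulVec_smul]
  refine ⟨Module.End.eigenspace (Matrix.toLin' (A ^ n)) μ, hμ, ?_,
    key A (by rw [← pow_succ, ← pow_succ']), key B hcomm⟩
  intro htop
  apply hdiag
  apply reducible_aux_diag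
  have hsc : ∀ v, (A ^ n).mulVec v = μ • v := by
    intro v
    have : v ∈ Module.End.eigenspace (Matrix.toLin' (A ^ n)) μ := htop ▸ Submodule.mem_top
    rwa [Module.End.mem_eigenspace_iff, Matrix.toLin'_apply] at this
  have hμ0 : μ ≠ 0 := by
    rintro rfl
    obtain ⟨v, hv, hv0⟩ := hμ.exists_hasEigenvector
    apply hv0
    have h1 := hsc v
    rw [zero_smul] at h1
    exact (Matrix.mulVec_injective_iff_isUnit.2 (hA.pow n)) (by rw [h1, Matrix.mulVec_zero])
  apply Module.End.IsSemisimple.iSup_eigenspace_eq_top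
  refine Module.End.isSemisimple_of_squarefree_aeval_eq_zero
    (p := Polynomial.X ^ n - Polynomial.C μ) ?_ ?_
  · exact (Polynomial.separable_X_pow_sub_C μ (by exact_mod_cast (by omega : n ≠ 0)) hμ0).squarefree
  · apply LinearMap.ext
    intro v
    have := hsc v
    simp only [map_sub, map_pow, Polynomial.aeval_X, Polynomial.aeval_C, ← Matrix.toLin'_pow,
      LinearMap.sub_apply, Matrix.toLin'_apply, Module.algebraMap_end_apply, this, sub_self,
      LinearMap.zero_apply]
end

section
/- Let n ≥ 1 and let (A, B) be a pair of matrices in SL_2(ℂ) with A^n B = B A^n. If the pair (A, B) is irreducible, then there exist λ ∈ ℂ with λ^{2n} = 1 and λ² ≠ 1, and an invertible matrix P ∈ GL_2(ℂ), such that P^{-1} A P is the diagonal matrix with diagonal entries λ and λ^{-1}. -/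
theorem eigvec_aux (M : Matrix (Fin 2) (Fin 2) ℂ) :
    ∃ (t : ℂ) (v : Fin 2 → ℂ), v ≠ 0 ∧ M.mulVec v = t • v := by
  obtain ⟨t, ht⟩ := Module.End.exists_eigenvalue (Matrix.toLin' M)
  obtain ⟨v, hv⟩ := ht.exists_hasEigenvector
  exact ⟨t, v, hv.2, by simpa using hv.apply_eq_smul⟩

theorem schur_aux (A B M : Matrix (Fin 2) (Fin 2) ℂ)
    (hA : M * A = A * M) (hB : M * B = B * M)
    (hirr : ¬ ∃ W : Submodule ℂ (Fin 2 → ℂ), W ≠ ⊥ ∧ W ≠ ⊤ ∧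
      (∀ v ∈ W, A.mulVec v ∈ W) ∧ (∀ v ∈ W, B.mulVec v ∈ W)) :
    ∃ c : ℂ, M = c • (1 : Matrix (Fin 2) (Fin 2) ℂ) := by
  obtain ⟨t, v, hv, htv⟩ := eigvec_aux M
  let W : Submodule ℂ (Fin 2 → ℂ) := Module.End.eigenspace (Matrix.toLin' M) t
  have hmem : ∀ x, x ∈ W ↔ M.mulVec x = t • x := fun x => by
    simp [W, Module.End.mem_eigenspace_iff]
  have hinv : ∀ C : Matrix (Fin 2) (Fin 2) ℂ, M * C = C * M → ∀ x ∈ W, C.mulVec x ∈ W := by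
    intro C hC x hx
    rw [hmem] at hx ⊢
    rw [Matrix.mulVec_mulVec, hC, ← Matrix.mulVec_mulVec, hx, Matrix.mulVec_smul]
  by_cases htop : W = ⊤
  · refine ⟨t, ?_⟩
    have h0 : ∀ x, M.mulVec x = t • x := fun x => (hmem x).1 (htop ▸ Submodule.mem_top)
    apply Matrix.toLin'.injective
    ext1 i
    ext1
    simp [h0, -Matrix.mulVec_single]
  · refine absurd ⟨W, ?_, htop, hinv A hA, hinv B hB⟩ hirr
    intro hbot
    have : v ∈ W := (hmem v).2 htv
    rw [hbot] at this
    exact hv (by simpa using this)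

theorem pow_aux (A : Matrix (Fin 2) (Fin 2) ℂ) (l : ℂ) (hl : l ^ 2 = 1)
    (hA : A * A = (2 * l) • A - 1) (k : ℕ) :
    l • A ^ k = l ^ (k + 1) • (1 : Matrix (Fin 2) (Fin 2) ℂ) + (k * l ^ k) • (A - l • 1) := by
  induction k with
  | zero => simp
  | succ k ih =>
    rw [pow_succ, ← smul_mul_assoc, ih]
    simp only [add_mul, sub_mul, smul_mul_assoc, one_mul, hA]
    have h1 : (1 : Matrix (Fin 2) (Fin 2) ℂ) = (l ^ 2) • 1 := by simp [hl]
    rw [show (2 * l) • A - (1 : Matrix (Fin 2) (Fin 2) ℂ) = (2 * l) • A - (l ^ 2) • 1 by simp [hl]]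
    push_cast
    module

theorem det_aux (A : Matrix (Fin 2) (Fin 2) ℂ) (t : ℂ) (v : Fin 2 → ℂ) (hv : v ≠ 0)
    (h : A.mulVec v = t • v) : (A 0 0 - t) * (A 1 1 - t) = A 0 1 * A 1 0 := by
  have : (A - t • 1).det = 0 := by
    rw [← Matrix.exists_mulVec_eq_zero_iff]
    exact ⟨v, hv, by simp [Matrix.sub_mulVec, h, Matrix.smul_mulVec]⟩
  rw [Matrix.det_fin_two] at this
  simp at this
  linear_combination this

theorem det_aux' (A : Matrix (Fin 2) (Fin 2) ℂ) (t : ℂ)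
    (h : (A 0 0 - t) * (A 1 1 - t) = A 0 1 * A 1 0) :
    ∃ v : Fin 2 → ℂ, v ≠ 0 ∧ A.mulVec v = t • v := by
  have : (A - t • 1).det = 0 := by
    rw [Matrix.det_fin_two]
    simp
    linear_combination h
  rw [← Matrix.exists_mulVec_eq_zero_iff] at this
  obtain ⟨v, hv, h⟩ := this
  rw [Matrix.sub_mulVec, Matrix.smul_mulVec, Matrix.one_mulVec, sub_eq_zero] at h
  exact ⟨v, hv, h⟩

/-- Let `n ≥ 1` and `(A, B)` a pair in `SL_2(ℂ)` with `A^n B = B A^n`. If `(A, B)` is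
irreducible, then there are `λ ∈ ℂ` with `λ^{2n} = 1`, `λ² ≠ 1`, and `P ∈ GL_2(ℂ)`
such that `P⁻¹ A P = diag(λ, λ⁻¹)`. -/
theorem irreducible_sl2_diagonal_form (n : ℕ) (hn : 1 ≤ n)
    (A B : Matrix.SpecialLinearGroup (Fin 2) ℂ)
    (hcomm : (A : Matrix (Fin 2) (Fin 2) ℂ) ^ n * (B : Matrix (Fin 2) (Fin 2) ℂ) =
      (B : Matrix (Fin 2) (Fin 2) ℂ) * (A : Matrix (Fin 2) (Fin 2) ℂ) ^ n)
    (hirr : ¬ ∃ W : Submodule ℂ (Fin 2 → ℂ), W ≠ ⊥ ∧ W ≠ ⊤ ∧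
      (∀ v ∈ W, (A : Matrix (Fin 2) (Fin 2) ℂ).mulVec v ∈ W) ∧
      (∀ v ∈ W, (B : Matrix (Fin 2) (Fin 2) ℂ).mulVec v ∈ W)) :
    ∃ (lam : ℂ) (P : GL (Fin 2) ℂ), lam ^ (2 * n) = 1 ∧ lam ^ 2 ≠ 1 ∧
      ((P⁻¹ : GL (Fin 2) ℂ) : Matrix (Fin 2) (Fin 2) ℂ) *
        (A : Matrix (Fin 2) (Fin 2) ℂ) * (P : Matrix (Fin 2) (Fin 2) ℂ) =
        Matrix.diagonal ![lam, lam⁻¹] := by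
  obtain ⟨A, hdA⟩ := A
  obtain ⟨B, hdB⟩ := B
  simp only at hcomm hirr ⊢
  obtain ⟨m, hm⟩ := schur_aux A B (A ^ n) ((Commute.refl A).pow_left n) hcomm hirr
  have hm2 : m ^ 2 = 1 := by
    have := congrArg Matrix.det hm
    simpa [Matrix.det_pow, hdA, Matrix.det_smul] using this.symm
  obtain ⟨l, v, hv, hlv⟩ := eigvec_aux A
  have hpow : ∀ k : ℕ, (A ^ k).mulVec v = l ^ k • v := by
    intro k
    induction k with
    | zero => simp
    | succ k ih =>
      rw [pow_succ, ← Matrix.mulVec_mulVec, hlv, Matrix.mulVec_smul, ih, smul_smul, pow_succ']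
  have hlm : l ^ n = m := by
    have h := hpow n
    rw [hm, Matrix.smul_mulVec, Matrix.one_mulVec] at h
    exact (smul_left_injective ℂ hv h).symm
  have hd := det_aux A l v hv hlv
  have hdet := hdA
  rw [Matrix.det_fin_two] at hdet
  have hl0 : l ≠ 0 := by
    rintro rfl
    apply one_ne_zero (α := ℂ)
    linear_combination hd - hdet
  have hl2 : l ^ 2 ≠ 1 := by
    intro hl2
    have htr : A 0 0 + A 1 1 = 2 * l := by
      linear_combination (-l) * hd + l * hdet + (l - (A 0 0 + A 1 1)) * hl2
    have hAA : A * A = (2 * l) • A - 1 := by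
      rw [← htr]
      ext i j
      fin_cases i <;> fin_cases j <;> simp [Matrix.mul_apply, Fin.sum_univ_two] <;>
        first | linear_combination (0 : ℂ) * hdet | linear_combination hdet | linear_combination -hdet
    have h1 := pow_aux A l hl2 hAA n
    rw [hm, ← hlm, smul_smul, ← pow_succ', left_eq_add, smul_eq_zero] at h1
    have hn0 : (n : ℂ) ≠ 0 := by exact_mod_cast (by omega : n ≠ 0)
    have hAl : A = l • 1 := sub_eq_zero.1 (h1.resolve_left (mul_ne_zero hn0 (pow_ne_zero _ hl0)))
    obtain ⟨c, hc⟩ := schur_aux A B B (by rw [hAl]; simp) rfl hirr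
    have key : ∀ (s : ℂ), ∀ x ∈ Submodule.span ℂ {(![1, 0] : Fin 2 → ℂ)},
        (s • (1 : Matrix (Fin 2) (Fin 2) ℂ)).mulVec x ∈
          Submodule.span ℂ {(![1, 0] : Fin 2 → ℂ)} := by
      intro s x hx
      rw [Matrix.smul_mulVec, Matrix.one_mulVec]
      exact Submodule.smul_mem _ _ hx
    refine hirr ⟨Submodule.span ℂ {![1, 0]}, ?_, ?_, ?_, ?_⟩
    · rw [Ne, Submodule.span_singleton_eq_bot]
      intro h
      simpa using congrFun h 0
    · intro h
      have : (![0, 1] : Fin 2 → ℂ) ∈ Submodule.span ℂ {(![1, 0] : Fin 2 → ℂ)} := by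
        rw [h]; trivial
      obtain ⟨a, ha⟩ := Submodule.mem_span_singleton.1 this
      simpa using congrFun ha 1
    · rw [hAl]; exact key l
    · rw [hc]; exact key c
  obtain ⟨w, hw, hlw⟩ := det_aux' A l⁻¹ (by
    field_simp
    linear_combination hd + (l ^ 2 - 1) * hdet)
  let Q : Matrix (Fin 2) (Fin 2) ℂ := !![v 0, w 0; v 1, w 1]
  have hAQ : A * Q = Q * Matrix.diagonal ![l, l⁻¹] := by
    have a0 := congrFun hlv 0
    have a1 := congrFun hlv 1
    have b0 := congrFun hlw 0
    have b1 := congrFun hlw 1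
    simp [Matrix.mulVec, dotProduct, Fin.sum_univ_two] at a0 a1 b0 b1
    ext i j
    fin_cases i <;> fin_cases j <;>
      simp [Q, Matrix.mul_apply, Fin.sum_univ_two, a0, a1, b0, b1] <;> ring
  have hQ : Q.det ≠ 0 := by
    intro h
    obtain ⟨c, hc, hQc⟩ := Matrix.exists_mulVec_eq_zero_iff.2 h
    have e1 : c 0 • v + c 1 • w = 0 := by
      ext i
      have := congrFun hQc i
      fin_cases i <;>
        simp [Q, Matrix.mulVec, dotProduct, Fin.sum_univ_two] at this ⊢ <;>
        linear_combination this
    have e2 : c 0 • (l • v) + c 1 • (l⁻¹ • w) = 0 := by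
      rw [← hlv, ← hlw, ← Matrix.mulVec_smul, ← Matrix.mulVec_smul, ← Matrix.mulVec_add, e1,
        Matrix.mulVec_zero]
    have e3 : (c 0 * (l - l⁻¹)) • v = 0 := by
      linear_combination (norm := module) e2 - l⁻¹ • e1
    have hne : l - l⁻¹ ≠ 0 := by
      intro h
      apply hl2
      field_simp at h
      linear_combination h
    have c0 : c 0 = 0 := by simpa [hv, hne] using e3
    have c1 : c 1 = 0 := by simpa [c0, hw] using e1
    exact hc (by ext i; fin_cases i <;> simp [c0, c1])
  refine ⟨l, Matrix.GeneralLinearGroup.mkOfDetNeZero Q hQ, ?_, hl2, ?_⟩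
  · rw [mul_comm, pow_mul, hlm, hm2]
  · set P := Matrix.GeneralLinearGroup.mkOfDetNeZero Q hQ with hP
    have hPQ : (P : Matrix (Fin 2) (Fin 2) ℂ) = Q := rfl
    rw [mul_assoc, hPQ, hAQ, ← hPQ, ← mul_assoc, Units.inv_mul, one_mul]
end

section
/- Let n ≥ 1. Let X be the set of irreducible pairs (A, B) ∈ SL_2(ℂ) × SL_2(ℂ) satisfying A^n B = B A^n, and consider the equivalence on X given by simultaneous conjugation: (A, B) ∼ (P^{-1}AP, P^{-1}BP) for P ∈ GL_2(ℂ). Then the quotient set X/∼ is in bijection with Q × {(a, d) ∈ ℂ² : ad ≠ 1}, where Q is the quotient of the finite set {λ ∈ ℂ : λ^{2n} = 1, λ² ≠ 1} by the equivalence λ ∼ λ^{-1}. -/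
/-- The set of irreducible pairs `(A, B) ∈ SL_2(ℂ)²` with `A^n B = B A^n`. -/
def irrPairs (n : ℕ) : Type :=
  {AB : Matrix.SpecialLinearGroup (Fin 2) ℂ × Matrix.SpecialLinearGroup (Fin 2) ℂ //
    (AB.1 : Matrix (Fin 2) (Fin 2) ℂ) ^ n * (AB.2 : Matrix (Fin 2) (Fin 2) ℂ) =
      (AB.2 : Matrix (Fin 2) (Fin 2) ℂ) * (AB.1 : Matrix (Fin 2) (Fin 2) ℂ) ^ n ∧
    ¬ ∃ W : Submodule ℂ (Fin 2 → ℂ), W ≠ ⊥ ∧ W ≠ ⊤ ∧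
      (∀ v ∈ W, (AB.1 : Matrix (Fin 2) (Fin 2) ℂ).mulVec v ∈ W) ∧
      (∀ v ∈ W, (AB.2 : Matrix (Fin 2) (Fin 2) ℂ).mulVec v ∈ W)}

/-- Simultaneous conjugation: `(A, B) ∼ (P⁻¹AP, P⁻¹BP)` for some `P ∈ GL_2(ℂ)`. -/
def conjRel (n : ℕ) (p q : irrPairs n) : Prop :=
  ∃ P : GL (Fin 2) ℂ,
    (q.1.1 : Matrix (Fin 2) (Fin 2) ℂ) =
      ((P⁻¹ : GL (Fin 2) ℂ) : Matrix (Fin 2) (Fin 2) ℂ) *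
        (p.1.1 : Matrix (Fin 2) (Fin 2) ℂ) * (P : Matrix (Fin 2) (Fin 2) ℂ) ∧
    (q.1.2 : Matrix (Fin 2) (Fin 2) ℂ) =
      ((P⁻¹ : GL (Fin 2) ℂ) : Matrix (Fin 2) (Fin 2) ℂ) *
        (p.1.2 : Matrix (Fin 2) (Fin 2) ℂ) * (P : Matrix (Fin 2) (Fin 2) ℂ)

/-- The set of `2n`-th roots of unity `λ` with `λ² ≠ 1`, modulo `λ ∼ λ⁻¹`. -/
def lamQuot (n : ℕ) : Type :=
  Quot (fun l m : {z : ℂ // z ^ (2 * n) = 1 ∧ z ^ 2 ≠ 1} =>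
    (m : ℂ) = (l : ℂ) ∨ (m : ℂ) = (l : ℂ)⁻¹)


abbrev HM2 := Matrix (Fin 2) (Fin 2) ℂ

def HIrr (A B : HM2) : Prop :=
  ¬ ∃ W : Submodule ℂ (Fin 2 → ℂ), W ≠ ⊥ ∧ W ≠ ⊤ ∧
      (∀ v ∈ W, A.mulVec v ∈ W) ∧ (∀ v ∈ W, B.mulVec v ∈ W)

lemma HIrr.no_common {A B : HM2} (h : HIrr A B) (v : Fin 2 → ℂ) (hv : v ≠ 0) (α β : ℂ)
    (hA : A.mulVec v = α • v) (hB : B.mulVec v = β • v) : False := by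
  apply h
  refine ⟨Submodule.span ℂ {v}, ?_, ?_, ?_, ?_⟩
  · simpa using hv
  · intro ht
    have h1 := finrank_span_singleton (K := ℂ) hv
    rw [ht, finrank_top] at h1
    simp at h1
  · intro x hx
    obtain ⟨c, rfl⟩ := Submodule.mem_span_singleton.1 hx
    rw [Matrix.mulVec_smul, hA]
    exact Submodule.smul_mem _ _ (Submodule.smul_mem _ _ (Submodule.mem_span_singleton_self v))
  · intro x hx
    obtain ⟨c, rfl⟩ := Submodule.mem_span_singleton.1 hx
    rw [Matrix.mulVec_smul, hB]
    exact Submodule.smul_mem _ _ (Submodule.smul_mem _ _ (Submodule.mem_span_singleton_self v))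

lemma HIrr.schur {A B : HM2} (h : HIrr A B) (M : HM2) (hA : M * A = A * M) (hB : M * B = B * M)
    (v : Fin 2 → ℂ) (hv : v ≠ 0) (c : ℂ) (hc : M.mulVec v = c • v) : M = c • (1 : HM2) := by
  by_contra hne
  apply h
  refine ⟨LinearMap.ker (Matrix.mulVecLin (M - c • (1 : HM2))), ?_, ?_, ?_, ?_⟩
  · intro hb
    have : v ∈ LinearMap.ker (Matrix.mulVecLin (M - c • (1 : HM2))) := by
      simp [Matrix.sub_mulVec, Matrix.smul_mulVec, hc]
    rw [hb] at this
    exact hv (by simpa using this)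
  · intro ht
    apply hne
    rw [← sub_eq_zero]
    apply Matrix.ext_of_mulVec_single
    intro i
    have : (Pi.single i 1 : Fin 2 → ℂ) ∈ LinearMap.ker (Matrix.mulVecLin (M - c • (1 : HM2))) := by
      rw [ht]; trivial
    rw [LinearMap.mem_ker, Matrix.mulVecLin_apply] at this
    rw [this, Matrix.zero_mulVec]
  all_goals
    intro x hx
    rw [LinearMap.mem_ker, Matrix.mulVecLin_apply] at hx ⊢
    rw [Matrix.mulVec_mulVec]
  · have : (M - c • (1 : HM2)) * A = A * (M - c • (1 : HM2)) := by
      rw [sub_mul, mul_sub, hA]; simp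
    rw [this, ← Matrix.mulVec_mulVec, hx, Matrix.mulVec_zero]
  · have : (M - c • (1 : HM2)) * B = B * (M - c • (1 : HM2)) := by
      rw [sub_mul, mul_sub, hB]; simp
    rw [this, ← Matrix.mulVec_mulVec, hx, Matrix.mulVec_zero]

lemma h_eigvec (A : HM2) (hd : A.det = 1) (l : ℂ) (hl : l * l - A.trace * l + 1 = 0) :
    ∃ v : Fin 2 → ℂ, v ≠ 0 ∧ A.mulVec v = l • v := by
  have : (A - l • (1 : HM2)).det = 0 := by
    rw [Matrix.det_fin_two] at hd ⊢
    rw [Matrix.trace_fin_two] at hl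
    simp
    linear_combination hl + hd
  obtain ⟨v, hv, h⟩ := Matrix.exists_mulVec_eq_zero_iff.2 this
  refine ⟨v, hv, ?_⟩
  rw [Matrix.sub_mulVec, Matrix.smul_mulVec, Matrix.one_mulVec] at h
  exact sub_eq_zero.1 h

lemma h_eigval (A : HM2) (hd : A.det = 1) :
    ∃ l : ℂ, l ≠ 0 ∧ l * l - A.trace * l + 1 = 0 := by
  obtain ⟨s, hs⟩ := IsAlgClosed.exists_pow_nat_eq (A.trace ^ 2 - 4) (n := 2) (by norm_num)
  have key : ((A.trace + s) / 2) * ((A.trace + s) / 2) - A.trace * ((A.trace + s) / 2) + 1 = 0 := by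
    linear_combination hs / 4
  refine ⟨_, ?_, key⟩
  intro h0
  rw [h0] at key
  simp at key

lemma h_pow_eig (A : HM2) (v : Fin 2 → ℂ) (l : ℂ) (h : A.mulVec v = l • v) (n : ℕ) :
    (A ^ n).mulVec v = l ^ n • v := by
  induction n with
  | zero => simp
  | succ k ih =>
    rw [pow_succ, ← Matrix.mulVec_mulVec, h, Matrix.mulVec_smul, ih, smul_smul, pow_succ, mul_comm]

lemma h_pow_unip (A : HM2) (l : ℂ)
    (h : (A - l • (1 : HM2)) * (A - l • (1 : HM2)) = 0) (n : ℕ) :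
    l • A ^ n = l ^ (n + 1) • (1 : HM2) + ((n : ℂ) * l ^ n) • (A - l • (1 : HM2)) := by
  obtain ⟨N, rfl⟩ : ∃ N, A = N + l • (1 : HM2) := ⟨A - l • 1, by simp⟩
  simp only [add_sub_cancel_right] at h ⊢
  induction n with
  | zero => simp
  | succ k ih =>
    rw [pow_succ, ← smul_mul_assoc, ih]
    simp only [add_mul, mul_add, smul_mul_assoc, mul_smul_comm, one_mul, mul_one, h, smul_zero,
      smul_smul]
    push_cast
    module

lemma h_eig_root {A B : HM2} (h : HIrr A B) (hA : A.det = 1) (hB : B.det = 1) (n : ℕ)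
    (hn : 1 ≤ n) (hc : A ^ n * B = B * A ^ n) (l : ℂ) (hl0 : l ≠ 0)
    (hl : l * l - A.trace * l + 1 = 0) : l ^ (2 * n) = 1 ∧ l ^ 2 ≠ 1 := by
  obtain ⟨v, hv, hAv⟩ := h_eigvec A hA l hl
  have hs := h.schur (A ^ n) (by rw [← pow_succ, ← pow_succ']) hc v hv _ (h_pow_eig A v l hAv n)
  constructor
  · have := congrArg Matrix.det hs
    rw [Matrix.det_pow, hA, Matrix.det_smul] at this
    simp at this
    rw [mul_comm, pow_mul]; exact this.symm
  · intro h1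
    have ht : A.trace = 2 * l := by
      have : l * (2 * l - A.trace) = 0 := by linear_combination hl + h1
      rcases mul_eq_zero.1 this with h | h
      · exact absurd h hl0
      · linear_combination -h
    have hN : (A - l • (1 : HM2)) * (A - l • (1 : HM2)) = 0 := by
      rw [Matrix.trace_fin_two] at ht
      rw [Matrix.det_fin_two] at hA
      ext i j
      fin_cases i <;> fin_cases j <;> simp [Matrix.mul_apply]
      · linear_combination A 0 0 * ht - hA + h1
      · linear_combination A 0 1 * ht
      · linear_combination A 1 0 * ht
      · linear_combination A 1 1 * ht - hA + h1
    have hu := h_pow_unip A l hN n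
    rw [hs, smul_smul, ← pow_succ', left_eq_add, smul_eq_zero] at hu
    have hAl : A = l • (1 : HM2) := by
      rcases hu with hu | hu
      · exfalso
        have : n ≠ 0 := by omega
        simp [hl0, this] at hu
      · exact sub_eq_zero.1 hu
    obtain ⟨m, -, hm⟩ := h_eigval B hB
    obtain ⟨w, hw, hBw⟩ := h_eigvec B hB m hm
    exact h.no_common w hw l m (by rw [hAl, Matrix.smul_mulVec, Matrix.one_mulVec]) hBw

lemma h_normal {A B : HM2} (h : HIrr A B) (hA : A.det = 1) (hB : B.det = 1) (l : ℂ) (hl0 : l ≠ 0)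
    (hl : l * l - A.trace * l + 1 = 0) (hl2 : l ^ 2 ≠ 1) :
    ∃ (P : HM2) (a d : ℂ), P.det ≠ 0 ∧ a * d ≠ 1 ∧ A * P = P * !![l, 0; 0, l⁻¹] ∧
      B * P = P * !![a, a * d - 1; 1, d] := by
  obtain ⟨v, hv, hAv⟩ := h_eigvec A hA l hl
  obtain ⟨w, hw, hAw⟩ := h_eigvec A hA l⁻¹ (by field_simp; linear_combination hl)
  have hll : l - l⁻¹ ≠ 0 := by
    intro h0; apply hl2; field_simp at h0; linear_combination h0
  have hdet : v 0 * w 1 - w 0 * v 1 ≠ 0 := by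
    intro h0
    have : (!![v 0, w 0; v 1, w 1] : HM2).det = 0 := by rw [Matrix.det_fin_two_of]; exact h0
    obtain ⟨x, hx, hPx⟩ := Matrix.exists_mulVec_eq_zero_iff.2 this
    have e : x 0 • v + x 1 • w = 0 := by
      ext i
      have := congrFun hPx i
      fin_cases i <;> simp [Matrix.mulVec, dotProduct] at this ⊢ <;> linear_combination this
    have e2 := congrArg A.mulVec e
    rw [Matrix.mulVec_add, Matrix.mulVec_smul, Matrix.mulVec_smul, hAv, hAw, Matrix.mulVec_zero] at e2
    have e3 : ((l - l⁻¹) * x 0) • v = 0 := by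
      have e4 : ((l - l⁻¹) * x 0) • v =
          (x 0 • l • v + x 1 • l⁻¹ • w) - l⁻¹ • (x 0 • v + x 1 • w) := by module
      rw [e4, e2, e, smul_zero, sub_zero]
    have hx0 : x 0 = 0 := by
      rcases smul_eq_zero.1 e3 with h | h
      · exact (mul_eq_zero.1 h).resolve_left hll
      · exact absurd h hv
    rw [hx0, zero_smul, zero_add] at e
    have hx1 : x 1 = 0 := (smul_eq_zero.1 e).resolve_right hw
    apply hx
    ext i; fin_cases i <;> simp [hx0, hx1]
  have dec : ∀ u : Fin 2 → ℂ, ∃ p q : ℂ, u = p • v + q • w := by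
    intro u
    refine ⟨(u 0 * w 1 - w 0 * u 1) / (v 0 * w 1 - w 0 * v 1),
      (v 0 * u 1 - u 0 * v 1) / (v 0 * w 1 - w 0 * v 1), ?_⟩
    ext i
    fin_cases i
    · change u 0 = _ / _ * v 0 + _ / _ * w 0
      rw [div_mul_eq_mul_div, div_mul_eq_mul_div, ← add_div, eq_div_iff hdet]
      ring
    · change u 1 = _ / _ * v 1 + _ / _ * w 1
      rw [div_mul_eq_mul_div, div_mul_eq_mul_div, ← add_div, eq_div_iff hdet]
      ring
  obtain ⟨a, c, hBv⟩ := dec (B.mulVec v)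
  obtain ⟨b, d, hBw⟩ := dec (B.mulVec w)
  have hc : c ≠ 0 := by
    rintro rfl
    exact h.no_common v hv l a hAv (by simpa using hBv)
  have hb : b ≠ 0 := by
    rintro rfl
    exact h.no_common w hw l⁻¹ d hAw (by simpa using hBw)
  have hP : (!![v 0, c * w 0; v 1, c * w 1] : HM2).det ≠ 0 := by
    rw [Matrix.det_fin_two_of]
    intro h0
    apply mul_ne_zero hc hdet
    linear_combination h0
  have hBP : B * !![v 0, c * w 0; v 1, c * w 1] =
      !![v 0, c * w 0; v 1, c * w 1] * !![a, b * c; 1, d] := by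
    have e0 := congrFun hBv 0
    have e1 := congrFun hBv 1
    have e2 := congrFun hBw 0
    have e3 := congrFun hBw 1
    simp [Matrix.mulVec, dotProduct] at e0 e1 e2 e3
    ext i j
    fin_cases i <;> fin_cases j <;> simp [Matrix.mul_apply]
    · linear_combination e0
    · linear_combination c * e2
    · linear_combination e1
    · linear_combination c * e3
  have hbc : b * c = a * d - 1 := by
    have := congrArg Matrix.det hBP
    rw [Matrix.det_mul, Matrix.det_mul, hB, one_mul, left_eq_mul₀ hP, Matrix.det_fin_two_of] at this
    linear_combination -this
  refine ⟨_, a, d, hP, ?_, ?_, ?_⟩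
  · intro h1
    apply mul_ne_zero hb hc
    rw [hbc, h1, sub_self]
  · have e0 := congrFun hAv 0
    have e1 := congrFun hAv 1
    have e2 := congrFun hAw 0
    have e3 := congrFun hAw 1
    simp [Matrix.mulVec, dotProduct] at e0 e1 e2 e3
    ext i j
    fin_cases i <;> fin_cases j <;> simp [Matrix.mul_apply]
    · linear_combination e0
    · linear_combination c * e2
    · linear_combination e1
    · linear_combination c * e3
  · rw [← hbc]; exact hBP

lemma h_mv (a b c d : ℂ) (x : Fin 2 → ℂ) :
    Matrix.mulVec !![a, b; c, d] x = ![a * x 0 + b * x 1, c * x 0 + d * x 1] := by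
  ext i; fin_cases i <;> simp [Matrix.mulVec, dotProduct]

lemma h_irr (l a d : ℂ) (hl0 : l ≠ 0) (hl2 : l ^ 2 ≠ 1) (had : a * d ≠ 1) :
    HIrr !![l, 0; 0, l⁻¹] !![a, a * d - 1; 1, d] := by
  rintro ⟨W, hb, ht, hA, hB⟩
  have hll : l - l⁻¹ ≠ 0 := by
    intro h0; apply hl2; field_simp at h0; linear_combination h0
  have hbb : a * d - 1 ≠ 0 := sub_ne_zero.2 had
  apply ht
  have hfull : (![1, 0] : Fin 2 → ℂ) ∈ W → (![0, 1] : Fin 2 → ℂ) ∈ W → W = ⊤ := by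
    intro h0 h1
    rw [eq_top_iff]
    intro x _
    have : x = x 0 • ![1, 0] + x 1 • ![0, 1] := by
      ext i; fin_cases i <;> simp
    rw [this]
    exact W.add_mem (W.smul_mem _ h0) (W.smul_mem _ h1)
  have h01 : (![1, 0] : Fin 2 → ℂ) ∈ W → (![0, 1] : Fin 2 → ℂ) ∈ W := by
    intro h0
    have : (![0, 1] : Fin 2 → ℂ) =
        Matrix.mulVec !![a, a * d - 1; 1, d] ![1, 0] - a • ![1, 0] := by
      rw [h_mv]; ext i; fin_cases i <;> simp
    rw [this]
    exact W.sub_mem (hB _ h0) (W.smul_mem _ h0)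
  have h10 : (![0, 1] : Fin 2 → ℂ) ∈ W → (![1, 0] : Fin 2 → ℂ) ∈ W := by
    intro h0
    have : (![1, 0] : Fin 2 → ℂ) = (a * d - 1)⁻¹ •
        (Matrix.mulVec !![a, a * d - 1; 1, d] ![0, 1] - d • ![0, 1]) := by
      rw [h_mv]; ext i; fin_cases i <;> simp [hbb]
    rw [this]
    exact W.smul_mem _ (W.sub_mem (hB _ h0) (W.smul_mem _ h0))
  obtain ⟨x, hx, hx0⟩ := W.ne_bot_iff.1 hb
  by_cases hx1 : x 0 = 0
  · have hx2 : x 1 ≠ 0 := by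
      intro h; apply hx0; ext i; fin_cases i <;> simp [hx1, h]
    have : (![0, 1] : Fin 2 → ℂ) ∈ W := by
      have : (![0, 1] : Fin 2 → ℂ) = (x 1)⁻¹ • x := by
        ext i; fin_cases i <;> simp [hx1, hx2]
      rw [this]; exact W.smul_mem _ hx
    exact hfull (h10 this) this
  · have : (![1, 0] : Fin 2 → ℂ) ∈ W := by
      have : (![1, 0] : Fin 2 → ℂ) = ((l - l⁻¹) * x 0)⁻¹ •
          (Matrix.mulVec !![l, 0; 0, l⁻¹] x - l⁻¹ • x) := by
        rw [h_mv]
        ext i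
        fin_cases i
        · have e : l * x 0 - l⁻¹ * x 0 = (l - l⁻¹) * x 0 := by ring
          change 1 = ((l - l⁻¹) * x 0)⁻¹ * (l * x 0 + 0 * x 1 - l⁻¹ * x 0)
          rw [zero_mul, add_zero, e, inv_mul_cancel₀ (mul_ne_zero hll hx1)]
        · change 0 = ((l - l⁻¹) * x 0)⁻¹ * (0 * x 0 + l⁻¹ * x 1 - l⁻¹ * x 1)
          ring
      rw [this]; exact W.smul_mem _ (W.sub_mem (hA _ hx) (W.smul_mem _ hx))
    exact hfull this (h01 this)

lemma h_root_ne {n : ℕ} (hn : 1 ≤ n) {l : ℂ} (h : l ^ (2 * n) = 1) : l ≠ 0 := by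
  rintro rfl
  rw [zero_pow (by omega)] at h
  exact zero_ne_one h

lemma h_diag_pow (x y : ℂ) (n : ℕ) :
    (!![x, 0; 0, y] : HM2) ^ n = !![x ^ n, 0; 0, y ^ n] := by
  induction n with
  | zero => ext i j; fin_cases i <;> fin_cases j <;> simp
  | succ k ih => rw [pow_succ, ih]; simp [pow_succ]

/-- The normal form pair. -/
noncomputable def hPair (n : ℕ) (hn : 1 ≤ n) (l : {z : ℂ // z ^ (2 * n) = 1 ∧ z ^ 2 ≠ 1})
    (p : {p : ℂ × ℂ // p.1 * p.2 ≠ 1}) : irrPairs n :=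
  ⟨(⟨!![l.1, 0; 0, l.1⁻¹], by
      rw [Matrix.det_fin_two_of, mul_inv_cancel₀ (h_root_ne hn l.2.1)]; ring⟩,
    ⟨!![p.1.1, p.1.1 * p.1.2 - 1; 1, p.1.2], by rw [Matrix.det_fin_two_of]; ring⟩), by
    have e : l.1⁻¹ ^ n = l.1 ^ n := by
      have h : l.1 ^ n * l.1 ^ n = 1 := by
        have h2 := l.2.1
        rw [← pow_add]
        convert h2 using 2
        ring
      rw [inv_pow]
      exact (eq_inv_of_mul_eq_one_left h).symm
    refine ⟨?_, h_irr l.1 p.1.1 p.1.2 (h_root_ne hn l.2.1) l.2.2 p.2⟩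
    change (!![l.1, 0; 0, l.1⁻¹] : HM2) ^ n * !![p.1.1, p.1.1 * p.1.2 - 1; 1, p.1.2] =
      !![p.1.1, p.1.1 * p.1.2 - 1; 1, p.1.2] * (!![l.1, 0; 0, l.1⁻¹] : HM2) ^ n
    rw [h_diag_pow, e]
    simp [mul_comm]⟩

lemma h_tr_conj (P : GL (Fin 2) ℂ) (M : HM2) :
    Matrix.trace (((P⁻¹ : GL (Fin 2) ℂ) : HM2) * M * (P : HM2)) = M.trace := by
  rw [Matrix.trace_mul_comm, ← mul_assoc, ← Units.val_mul, mul_inv_cancel, Units.val_one, one_mul]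

/-- Trace invariants. -/
noncomputable def hInv (n : ℕ) : Quot (conjRel n) → ℂ × ℂ × ℂ :=
  Quot.lift (fun p => ((p.1.1 : HM2).trace, (p.1.2 : HM2).trace, ((p.1.1 : HM2) * (p.1.2 : HM2)).trace))
    (by
      rintro p q ⟨P, h1, h2⟩
      have h3 : (q.1.1 : HM2) * (q.1.2 : HM2) =
          ((P⁻¹ : GL (Fin 2) ℂ) : HM2) * ((p.1.1 : HM2) * (p.1.2 : HM2)) * (P : HM2) := by
        rw [h1, h2]
        have : (P : HM2) * ((P⁻¹ : GL (Fin 2) ℂ) : HM2) = 1 := by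
          rw [← Units.val_mul, mul_inv_cancel, Units.val_one]
        calc _ = ((P⁻¹ : GL (Fin 2) ℂ) : HM2) * (p.1.1 : HM2) *
              ((P : HM2) * ((P⁻¹ : GL (Fin 2) ℂ) : HM2)) * (p.1.2 : HM2) * (P : HM2) := by
              simp only [mul_assoc]
          _ = _ := by rw [this]; simp only [mul_assoc, one_mul]
      beta_reduce
      rw [h3, h1, h2, h_tr_conj, h_tr_conj, h_tr_conj])

lemma h_sum_inv {l m : ℂ} (hl : l ≠ 0) (hm : m ≠ 0) (h : l + l⁻¹ = m + m⁻¹) :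
    m = l ∨ m = l⁻¹ := by
  have : (m - l) * (m * l - 1) = 0 := by
    field_simp at h
    linear_combination -h
  rcases mul_eq_zero.1 this with h | h
  · left; linear_combination h
  · right; exact eq_inv_of_mul_eq_one_left (by linear_combination h)

/-- The quotient by simultaneous conjugation of the set of irreducible pairs
`(A, B) ∈ SL_2(ℂ)²` with `A^n B = B A^n` is in bijection with
`Q × {(a, d) ∈ ℂ² : ad ≠ 1}`, where `Q` is the set of `λ` with `λ^{2n} = 1`,
`λ² ≠ 1` modulo `λ ∼ λ⁻¹`. -/
theorem irr_character_variety_sl2 (n : ℕ) (hn : 1 ≤ n) :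
    Nonempty (Quot (conjRel n) ≃ lamQuot n × {p : ℂ × ℂ // p.1 * p.2 ≠ 1}) := by
  refine Nonempty.map Equiv.symm ?_
  refine ⟨Equiv.ofBijective (fun x => Quot.mk _ (hPair n hn (Quot.out x.1) x.2)) ⟨?_, ?_⟩⟩
  · rintro ⟨q, p⟩ ⟨q', p'⟩ h
    have h' := congrArg (hInv n) h
    simp only [hInv, hPair, Prod.mk.injEq, Matrix.trace_fin_two] at h'
    obtain ⟨h1, h2, h3⟩ := h'
    simp [Matrix.mul_apply] at h1 h2 h3
    have hq : q = q' := by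
      rw [← Quot.out_eq q, ← Quot.out_eq q']
      exact Quot.sound (h_sum_inv (h_root_ne hn (Quot.out q).2.1) (h_root_ne hn (Quot.out q').2.1) h1)
    subst hq
    have hl0 := h_root_ne hn (Quot.out q).2.1
    have hl2 := (Quot.out q).2.2
    generalize (Quot.out q).1 = l at *
    have hll : l - l⁻¹ ≠ 0 := by
      intro h0; apply hl2; field_simp at h0; linear_combination h0
    have ha : p.1.1 = p'.1.1 := by
      apply mul_left_cancel₀ hll
      linear_combination h3 - l⁻¹ * h2
    have hd : p.1.2 = p'.1.2 := by linear_combination h2 - ha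
    have hp : p = p' := Subtype.ext (Prod.ext ha hd)
    rw [hp]
  · intro y
    obtain ⟨⟨⟨A, B⟩, hc, hirr⟩, rfl⟩ := Quot.exists_rep y
    simp only at hc hirr
    obtain ⟨m, hm0, hm⟩ := h_eigval A A.2
    have hmr := h_eig_root hirr A.2 B.2 n hn hc m hm0 hm
    let q : lamQuot n := Quot.mk _ ⟨m, hmr⟩
    have hlm : ((Quot.out q).1 : ℂ) + (Quot.out q).1⁻¹ = m + m⁻¹ := by
      have key : ∀ r : lamQuot n, Quot.lift
          (fun z : {z : ℂ // z ^ (2 * n) = 1 ∧ z ^ 2 ≠ 1} => (z : ℂ) + (z : ℂ)⁻¹)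
          (by
            rintro a b (h | h)
            · simp only [h]
            · simp only [h, inv_inv]; ring) r = ((Quot.out r).1 : ℂ) + (Quot.out r).1⁻¹ := by
        intro r
        conv_lhs => rw [← Quot.out_eq r]
      rw [← key q]
    have hl0 := h_root_ne hn (Quot.out q).2.1
    have ht : (A : HM2).trace = m + m⁻¹ := by
      field_simp; linear_combination -hm
    have hl : (Quot.out q).1 * (Quot.out q).1 - (A : HM2).trace * (Quot.out q).1 + 1 = 0 := by
      rw [ht, ← hlm, add_mul, inv_mul_cancel₀ hl0]; ring
    obtain ⟨P, a, d, hP, had, h1, h2⟩ := h_normal hirr A.2 B.2 _ hl0 hl (Quot.out q).2.2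
    refine ⟨(q, ⟨(a, d), had⟩), ?_⟩
    symm
    apply Quot.sound
    let U : GL (Fin 2) ℂ := Matrix.GeneralLinearGroup.mkOfDetNeZero P hP
    have hU : ((U⁻¹ : GL (Fin 2) ℂ) : HM2) * P = 1 := by
      change ((U⁻¹ : GL (Fin 2) ℂ) : HM2) * (U : HM2) = 1
      rw [← Units.val_mul, inv_mul_cancel, Units.val_one]
    refine ⟨U, ?_, ?_⟩
    · change !![(Quot.out q).1, 0; 0, (Quot.out q).1⁻¹] = ((U⁻¹ : GL (Fin 2) ℂ) : HM2) * (A : HM2) * P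
      rw [mul_assoc, h1, ← mul_assoc, hU, one_mul]
    · change !![a, a * d - 1; 1, d] = ((U⁻¹ : GL (Fin 2) ℂ) : HM2) * (B : HM2) * P
      rw [mul_assoc, h2, ← mul_assoc, hU, one_mul]
end
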